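/- Let k be a commutative ring, P̂ a finite poset with top element 1̂ (write P = P̂ − {1̂}), and M a left-bounded cochain complex of P̂-representations in k-modules (or in sheaves of k-modules). Then for any free resolution G → k{*}_P and any free resolution F → S_{1̂}, the complex cone(G ⊗_{P̂} M → M_{1̂}), where the map is induced by the structure maps of M into M_{1̂}, is quasi-isomorphic to F ⊗_{P̂} M. In particular, F ⊗_{P̂} M is acyclic if and only if the map G ⊗_{P̂} M → M_{1̂} is a quasi-isomorphism (i.e. M is P̂-exact). -/

import Mathlib

/-!
STATEMENT 4: Let k be a commutative ring, P̂ a finite poset with top element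
1̂, and M a left-bounded cochain complex of P̂-representations in k-modules.
Then for any free resolution G → k{*}_P and any free resolution F → S_{1̂},
the complex cone(G ⊗_{P̂} M → M_{1̂}) (the map being induced by the structure
maps of M into M_{1̂} via the augmentation) is quasi-isomorphic to F ⊗_{P̂} M.
In particular F ⊗_{P̂} M is acyclic iff the map G ⊗_{P̂} M → M_{1̂} is a
quasi-isomorphism (i.e. M is P̂-exact).

Quasi-isomorphisms of (unbundled) complexes are expressed by exactness of the
mapping cone.
-/

open scoped DirectSum

noncomputable section

namespace PosetRep

variable (k : Type) [CommRing k] (P : Type) [PartialOrder P]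

/-- A representation of a poset `P` (viewed as a category with a unique
morphism `p → q` whenever `p ≤ q`) in `k`-modules. -/
structure PRep where
  M : P → Type
  [acg : ∀ p, AddCommGroup (M p)]
  [mod : ∀ p, Module k (M p)]
  map : ∀ {p q : P}, p ≤ q → (M p →ₗ[k] M q)
  map_refl : ∀ (p : P) (x : M p), map (le_refl p) x = x
  map_trans : ∀ {p q r : P} (hpq : p ≤ q) (hqr : q ≤ r) (x : M p),
    map hqr (map hpq x) = map (hpq.trans hqr) x

/-- A representation of the opposite poset `P^op` in `k`-modules. -/
structure PRepOp where
  M : P → Type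
  [acg : ∀ p, AddCommGroup (M p)]
  [mod : ∀ p, Module k (M p)]
  map : ∀ {p q : P}, p ≤ q → (M q →ₗ[k] M p)
  map_refl : ∀ (p : P) (x : M p), map (le_refl p) x = x
  map_trans : ∀ {p q r : P} (hpq : p ≤ q) (hqr : q ≤ r) (x : M r),
    map hpq (map hqr x) = map (hpq.trans hqr) x

attribute [instance] PRep.acg PRep.mod PRepOp.acg PRepOp.mod

variable {k P}

/-- Morphisms of `P`-representations. -/
structure RepHom (A B : PRep k P) where
  f : ∀ p, A.M p →ₗ[k] B.M p
  comm : ∀ {p q : P} (h : p ≤ q) (x : A.M p), f q (A.map h x) = B.map h (f p x)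

/-- Morphisms of `P^op`-representations. -/
structure RepOpHom (A B : PRepOp k P) where
  f : ∀ p, A.M p →ₗ[k] B.M p
  comm : ∀ {p q : P} (h : p ≤ q) (x : A.M q), f p (A.map h x) = B.map h (f q x)

variable (k P)

/-- The free `P^op`-module on a basis `B` with degrees `deg : B → P`; its value
at `p` is the free module on `{b : B // p ≤ deg b}`.  (`kP̂(−, q)` is the case
of a single basis element of degree `q`.) -/
def FreeOp (B : Type) (deg : B → P) : PRepOp k P where
  M p := {b : B // p ≤ deg b} →₀ k
  map {p q} h := Finsupp.lmapDomain k k (fun b => ⟨b.1, h.trans b.2⟩)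
  map_refl p x := by
    show Finsupp.mapDomain _ x = x
    have : (fun b : {b : B // p ≤ deg b} => (⟨b.1, (le_refl p).trans b.2⟩ :
        {b : B // p ≤ deg b})) = id := by
      funext b; rfl
    rw [this, Finsupp.mapDomain_id]
  map_trans {p q r} hpq hqr x := by
    show Finsupp.mapDomain _ (Finsupp.mapDomain _ x) = Finsupp.mapDomain _ x
    rw [← Finsupp.mapDomain_comp]
    rfl

/-- The canonical generator of the free module at a basis element. -/
def genOp (B : Type) (deg : B → P) (b : B) : (FreeOp k P B deg).M (deg b) :=
  Finsupp.single ⟨b, le_refl _⟩ 1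

/-- The submodule of `V` which is everything if `p = q` and `0` otherwise. -/
def diagSubmodule (p q : P) (V : Type) [AddCommGroup V] [Module k V] :
    Submodule k V where
  carrier := {v : V | p ≠ q → v = 0}
  zero_mem' := fun _ => rfl
  add_mem' := by
    intro a b ha hb
    intro h
    rw [ha h, hb h, add_zero]
  smul_mem' := by
    intro c v hv
    intro h
    simp only [Set.mem_setOf_eq] at hv ⊢
    rw [hv h, smul_zero]

open Classical in
/-- The "simple" `P^op`-representation `S_q ⊗ V`: the value is `V` at `q` and
`0` elsewhere, with all structure maps zero (except the identity at `q`). -/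
def SimpleOp (q : P) (V : Type) [AddCommGroup V] [Module k V] : PRepOp k P where
  M p := ↥(diagSubmodule k P p q V)
  map {p p'} _ :=
    { toFun := fun x => ⟨if p = p' then (x : V) else 0, by
        intro hpq
        by_cases hpp' : p = p'
        · simp only [hpp', if_true]
          exact x.2 (hpp' ▸ hpq)
        · simp [hpp']⟩
      map_add' := by
        intro x y
        apply Subtype.ext
        by_cases hpp' : p = p' <;> simp [hpp']
      map_smul' := by
        intro c x
        apply Subtype.ext
        by_cases hpp' : p = p' <;> simp [hpp'] }
  map_refl p x := by
    apply Subtype.ext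
    simp
  map_trans {p q' r} hpq hqr x := by
    apply Subtype.ext
    by_cases hpr : p = r
    · have hq' : p = q' := le_antisymm hpq (hpr ▸ hqr)
      have hq'r : q' = r := hq' ▸ hpr
      simp [hpr, hq', hq'r]
    · by_cases hpq' : p = q'
      · have : ¬ q' = r := fun h => hpr (hpq'.trans h)
        simp [hpq', hpr, this]
      · simp [hpq', hpr]

open Classical in
/-- The "simple" `P`-representation `S_q ⊗ V` (covariant version). -/
def Simple (q : P) (V : Type) [AddCommGroup V] [Module k V] : PRep k P where
  M p := ↥(diagSubmodule k P p q V)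
  map {p p'} _ :=
    { toFun := fun x => ⟨if p = p' then (x : V) else 0, by
        intro hpq
        by_cases hpp' : p = p'
        · simp only [hpp', if_true]
          exact x.2 (fun h => hpq (hpp' ▸ h))
        · simp [hpp']⟩
      map_add' := by
        intro x y
        apply Subtype.ext
        by_cases hpp' : p = p' <;> simp [hpp']
      map_smul' := by
        intro c x
        apply Subtype.ext
        by_cases hpp' : p = p' <;> simp [hpp'] }
  map_refl p x := by
    apply Subtype.ext
    simp
  map_trans {p q' r} hpq hqr x := by
    apply Subtype.ext
    by_cases hpr : p = r
    · have hq' : p = q' := le_antisymm hpq (hpr ▸ hqr)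
      have hq'r : q' = r := hq' ▸ hpr
      simp [hpr, hq', hq'r]
    · by_cases hpq' : p = q'
      · have : ¬ q' = r := fun h => hpr (hpq'.trans h)
        simp [hpq', hpr, this]
      · simp [hpq', hpr]

/-- A free resolution `⋯ → F₁ → F₀ → A → 0` of a `P^op`-representation `A` by
free modules, given by bases `B t` and degree functions `deg t`. -/
structure FreeRes (A : PRepOp k P) where
  B : ℕ → Type
  deg : ∀ t, B t → P
  d : ∀ t, RepOpHom (FreeOp k P (B (t + 1)) (deg (t + 1))) (FreeOp k P (B t) (deg t))
  aug : RepOpHom (FreeOp k P (B 0) (deg 0)) A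
  aug_surj : ∀ p, Function.Surjective ((aug.f) p)
  aug_d : ∀ p x, aug.f p ((d 0).f p x) = 0
  dd : ∀ t p x, (d t).f p ((d (t + 1)).f p x) = 0
  exact_aug : ∀ p x, aug.f p x = 0 → ∃ y, (d 0).f p y = x
  exact_d : ∀ t p x, (d t).f p x = 0 → ∃ y, (d (t + 1)).f p y = x

variable {k P}

/-- The tensor product over `P̂` of a free `P^op`-module with a
`P`-representation `N` is the direct sum `⨁_b N_{deg b}`. -/
abbrev tensorObj (B : Type) (deg : B → P) (N : PRep k P) : Type :=
  ⨁ b : B, N.M (deg b)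

/-- The map `F ⊗_P̂ N → F' ⊗_P̂ N` induced by a morphism of free
`P^op`-modules. -/
def tensorMap {B B' : Type} {deg : B → P} {deg' : B' → P}
    (φ : RepOpHom (FreeOp k P B deg) (FreeOp k P B' deg')) (N : PRep k P) :
    tensorObj B deg N →ₗ[k] tensorObj B' deg' N :=
  letI := Classical.decEq B
  letI := Classical.decEq B'
  DirectSum.toModule k B _ fun b =>
    Finsupp.sum (φ.f (deg b) (genOp k P B deg b))
      (fun i c => c • ((DirectSum.lof k B' (fun b' => N.M (deg' b')) i.1).comp
        (N.map i.2)))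

/-- Homology of a pair of composable linear maps. -/
abbrev homologyAt {A B C : Type} [AddCommGroup A] [Module k A] [AddCommGroup B]
    [Module k B] [AddCommGroup C] [Module k C]
    (dp : A →ₗ[k] B) (d : B →ₗ[k] C) : Type :=
  ↥(LinearMap.ker d) ⧸
    Submodule.comap (LinearMap.ker d).subtype (LinearMap.range dp)

/-- `Tor_i^{P̂}(A, N)`, computed from a chosen free resolution of `A`. -/
def Tor {A : PRepOp k P} (R : FreeRes k P A) (N : PRep k P) : ℕ → Type
  | 0 => (tensorObj (R.B 0) (R.deg 0) N) ⧸ LinearMap.range (tensorMap (R.d 0) N)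
  | (i + 1) => homologyAt (tensorMap (R.d (i + 1)) N) (tensorMap (R.d i) N)

instance {A : PRepOp k P} (R : FreeRes k P A) (N : PRep k P) (i : ℕ) :
    AddCommGroup (Tor R N i) := by
  cases i with
  | zero => exact inferInstanceAs (AddCommGroup ((tensorObj (R.B 0) (R.deg 0) N) ⧸
      LinearMap.range (tensorMap (R.d 0) N)))
  | succ i => exact inferInstanceAs (AddCommGroup
      (homologyAt (tensorMap (R.d (i + 1)) N) (tensorMap (R.d i) N)))

instance {A : PRepOp k P} (R : FreeRes k P A) (N : PRep k P) (i : ℕ) :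
    Module k (Tor R N i) := by
  cases i with
  | zero => exact inferInstanceAs (Module k ((tensorObj (R.B 0) (R.deg 0) N) ⧸
      LinearMap.range (tensorMap (R.d 0) N)))
  | succ i => exact inferInstanceAs (Module k
      (homologyAt (tensorMap (R.d (i + 1)) N) (tensorMap (R.d i) N)))

/-! ### Unbundled ℤ-indexed cochain complexes of `k`-modules -/

variable (k)

/-- An (unbundled) ℤ-indexed family of modules with maps of degree one.  The
condition `d² = 0` is not part of the data. -/
structure ZComplex where
  X : ℤ → Type
  [acg : ∀ m, AddCommGroup (X m)]
  [mod : ∀ m, Module k (X m)]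
  d : ∀ m, X m →ₗ[k] X (m + 1)

attribute [instance] ZComplex.acg ZComplex.mod

variable {k}

/-- `d² = 0`. -/
def ZComplex.IsComplex (C : ZComplex k) : Prop :=
  ∀ (m : ℤ) (x : C.X m), C.d (m + 1) (C.d m x) = 0

/-- Exactness at the spot `m+1`. -/
def ZComplex.ExactAt (C : ZComplex k) (m : ℤ) : Prop :=
  ∀ x : C.X (m + 1), C.d (m + 1) x = 0 → ∃ y : C.X m, C.d m y = x

/-- Exactness everywhere. -/
def ZComplex.Exact (C : ZComplex k) : Prop :=
  ∀ m : ℤ, C.ExactAt m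

/-- The mapping cone of a (raw) family of maps between complexes.  (It is the
honest mapping cone when the family is a chain map.) -/
def mapConeRaw {C D : ZComplex k} (f : ∀ m, C.X m →ₗ[k] D.X m) : ZComplex k where
  X m := C.X (m + 1) × D.X m
  d m := LinearMap.prod
    (-((C.d (m + 1)).comp (LinearMap.fst k (C.X (m + 1)) (D.X m))))
    ((f (m + 1)).comp (LinearMap.fst k (C.X (m + 1)) (D.X m)) +
      (D.d m).comp (LinearMap.snd k (C.X (m + 1)) (D.X m)))

/-- A family of maps is a quasi-isomorphism when its mapping cone is exact. -/
def IsQuasiIsoRaw {C D : ZComplex k} (f : ∀ m, C.X m →ₗ[k] D.X m) : Prop :=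
  ZComplex.Exact (mapConeRaw f)

/-- A chain map between raw complexes. -/
def IsChainMap {C D : ZComplex k} (f : ∀ m, C.X m →ₗ[k] D.X m) : Prop :=
  ∀ (m : ℤ) (x : C.X m), f (m + 1) (C.d m x) = D.d m (f m x)

end PosetRep

namespace PosetRep

variable {k : Type} [CommRing k] {P : Type} [PartialOrder P]

/-- Transport along an equality of (cohomological) degrees. -/
def Mcast {M : ℤ → PRep k P} {p : P} : ∀ {s s' : ℤ}, s = s' →
    ((M s).M p →ₗ[k] (M s').M p)
  | _, _, rfl => LinearMap.id

/-- The `(m,t)`-component `⨁_{b : B t} (M^{m+t})_{deg b}` of the total complex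
of the tensor product of a free resolution with a cochain complex `M` of
`P̂`-representations. -/
abbrev TTcomp {A : PRepOp k P} (R : FreeRes k P A) (M : ℤ → PRep k P)
    (m : ℤ) (t : ℕ) : Type :=
  ⨁ (b : R.B t), (M (m + (t : ℤ))).M (R.deg t b)

/-- The part of the total differential induced by the differential of `M`
(with the sign `(-1)^t`). -/
def ttA {A : PRepOp k P} (R : FreeRes k P A) (M : ℤ → PRep k P)
    (dM : ∀ s, RepHom (M s) (M (s + 1))) (m : ℤ) (t : ℕ) :
    TTcomp R M m t →ₗ[k] TTcomp R M (m + 1) t :=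
  letI := Classical.decEq (R.B t)
  DirectSum.toModule k (R.B t) _ (fun b =>
    ((-1 : k) ^ t) •
      ((DirectSum.lof k (R.B t)
          (fun b' => (M ((m + 1) + (t : ℤ))).M (R.deg t b')) b).comp
        ((Mcast (show (m + (t : ℤ)) + 1 = (m + 1) + (t : ℤ) by ring)).comp
          ((dM (m + (t : ℤ))).f (R.deg t b)))))

/-- The part of the total differential induced by the differential of the free
resolution, acting through the structure maps of `M`. -/
def ttB {A : PRepOp k P} (R : FreeRes k P A) (M : ℤ → PRep k P)
    (m : ℤ) (t' : ℕ) :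
    TTcomp R M m (t' + 1) →ₗ[k] TTcomp R M (m + 1) t' :=
  letI := Classical.decEq (R.B (t' + 1))
  letI := Classical.decEq (R.B t')
  DirectSum.toModule k (R.B (t' + 1)) _ (fun b =>
    Finsupp.sum ((R.d t').f (R.deg (t' + 1) b) (genOp k P _ _ b))
      (fun i c => c •
        ((DirectSum.lof k (R.B t')
            (fun b' => (M ((m + 1) + (t' : ℤ))).M (R.deg t' b')) i.1).comp
          ((Mcast (show m + (((t' : ℕ) + 1 : ℕ) : ℤ) = (m + 1) + (t' : ℤ) by
              push_cast; ring)).comp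
            ((M (m + (((t' : ℕ) + 1 : ℕ) : ℤ))).map i.2)))))

/-- The total complex of the tensor product `F ⊗_{P̂} M` of a free resolution
`F → A` with a cochain complex `M` of `P̂`-representations: its `m`-th term is
`⊕_{s-t=m} F_t ⊗_{P̂} M^s = ⨁_t ⨁_{b : B t} (M^{m+t})_{deg b}`. -/
def TotalTensor {A : PRepOp k P} (R : FreeRes k P A) (M : ℤ → PRep k P)
    (dM : ∀ s, RepHom (M s) (M (s + 1))) : ZComplex k where
  X m := ⨁ (t : ℕ), TTcomp R M m t
  d m :=
    letI := Classical.decEq ℕ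
    DirectSum.toModule k ℕ _ (fun t =>
      (DirectSum.lof k ℕ (TTcomp R M (m + 1)) t).comp (ttA R M dM m t) +
        (match t with
          | 0 => 0
          | (t' + 1) =>
            (DirectSum.lof k ℕ (TTcomp R M (m + 1)) t').comp (ttB R M m t')))

/-- The complex `m ↦ M^m_{1̂}` of values at the top element. -/
def TopComplex [OrderTop P] (M : ℤ → PRep k P)
    (dM : ∀ s, RepHom (M s) (M (s + 1))) : ZComplex k where
  X m := (M m).M ⊤
  d m := (dM m).f ⊤

/-- The submodule of `k` of elements vanishing if `p` is the top element. -/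
def coStarSubmodule (P : Type) [PartialOrder P] [OrderTop P]
    (k : Type) [CommRing k] (p : P) : Submodule k k where
  carrier := {v : k | p = ⊤ → v = 0}
  zero_mem' := fun _ => rfl
  add_mem' := by
    intro a b ha hb h
    rw [ha h, hb h, add_zero]
  smul_mem' := by
    intro c v hv h
    simp only [Set.mem_setOf_eq] at hv ⊢
    rw [hv h, smul_zero]

/-- The `P̂^op`-representation `k{*}_P`: the value is `k` at every `p ≠ 1̂` and
`0` at `1̂`, with identity structure maps among the elements of `P`. -/
def kStar (k : Type) [CommRing k] (P : Type) [PartialOrder P] [OrderTop P] :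
    PRepOp k P where
  M p := ↥(coStarSubmodule P k p)
  map {p q} h :=
    { toFun := fun x => ⟨(x : k), fun hp => x.2 (top_unique (hp ▸ h))⟩
      map_add' := fun _ _ => Subtype.ext rfl
      map_smul' := fun _ _ => Subtype.ext rfl }
  map_refl := fun _ _ => Subtype.ext rfl
  map_trans := fun _ _ _ => Subtype.ext rfl

/-- The underlying scalar of an element of a value of `k{*}_P`. -/
def kStarVal [OrderTop P] {p : P} (x : (kStar k P).M p) : k := x.1

/-- The canonical map `(G ⊗_{P̂} M)^m → M^m_{1̂}` induced by the augmentation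
of a free resolution `G → k{*}_P` and the structure maps of `M`. -/
def augToTop [OrderTop P] (R : FreeRes k P (kStar k P)) (M : ℤ → PRep k P)
    (dM : ∀ s, RepHom (M s) (M (s + 1))) (m : ℤ) :
    (TotalTensor R M dM).X m →ₗ[k] (TopComplex M dM).X m :=
  letI := Classical.decEq ℕ
  DirectSum.toModule k ℕ _ (fun t =>
    match t with
    | 0 =>
      letI := Classical.decEq (R.B 0)
      DirectSum.toModule k (R.B 0) _ (fun b =>
        (kStarVal (R.aug.f (R.deg 0 b) (genOp k P _ _ b))) •
          (((M m).map (le_top)).comp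
            (Mcast (show m + ((0 : ℕ) : ℤ) = m by simp))))
    | (_ + 1) => 0)

end PosetRep

open PosetRep

namespace PosetRep

section Comparison

variable {k : Type} [CommRing k] {P : Type} [PartialOrder P]

/-- The identity morphism of a `P^op`-representation. -/
def RepOpHom.id (A : PRepOp k P) : RepOpHom A A where
  f _ := LinearMap.id
  comm _ _ := rfl

/-- Composition of morphisms of `P^op`-representations. -/
def RepOpHom.comp {A B C : PRepOp k P} (g : RepOpHom B C) (f : RepOpHom A B) :
    RepOpHom A C where
  f p := (g.f p).comp (f.f p)
  comm h x := by simp [f.comm, g.comm]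

/-- Difference of morphisms of `P^op`-representations. -/
def RepOpHom.sub {A B : PRepOp k P} (f g : RepOpHom A B) : RepOpHom A B where
  f p := f.f p - g.f p
  comm h x := by simp [f.comm, g.comm]

/-- Negation of a morphism of `P^op`-representations. -/
def RepOpHom.neg {A B : PRepOp k P} (f : RepOpHom A B) : RepOpHom A B where
  f p := -f.f p
  comm h x := by simp [f.comm]

@[simp] lemma RepOpHom.id_apply (A : PRepOp k P) (p : P) (x : A.M p) :
    (RepOpHom.id A).f p x = x := rfl

@[simp] lemma RepOpHom.comp_apply {A B C : PRepOp k P} (g : RepOpHom B C)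
    (f : RepOpHom A B) (p : P) (x : A.M p) :
    (g.comp f).f p x = g.f p (f.f p x) := rfl

@[simp] lemma RepOpHom.sub_apply {A B : PRepOp k P} (f g : RepOpHom A B) (p : P)
    (x : A.M p) : (f.sub g).f p x = f.f p x - g.f p x := rfl

lemma FreeOp_map_genOp {B : Type} {deg : B → P} (b : B) {p : P} (h : p ≤ deg b) :
    (FreeOp k P B deg).map h (genOp k P B deg b) =
      Finsupp.single (⟨b, h⟩ : {b : B // p ≤ deg b}) (1 : k) :=
  Finsupp.mapDomain_single

/-- Linear maps out of a value of a free module agree if they agree on the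
restrictions of the generators. -/
lemma FreeOp_lhom_ext {B : Type} {deg : B → P} {p : P} {V : Type} [AddCommGroup V]
    [Module k V] {f g : (FreeOp k P B deg).M p →ₗ[k] V}
    (h : ∀ (b : B) (hb : p ≤ deg b),
      f ((FreeOp k P B deg).map hb (genOp k P B deg b)) =
        g ((FreeOp k P B deg).map hb (genOp k P B deg b))) : f = g := by
  refine Finsupp.lhom_ext' (M := k) fun b => LinearMap.ext_ring ?_
  have := h b.1 b.2
  rw [FreeOp_map_genOp] at this
  exact this

/-- The linear map out of a value of a free module with prescribed values on the
restrictions of the generators. -/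
def FreeOp_desc {B : Type} {deg : B → P} {p : P} {V : Type} [AddCommGroup V]
    [Module k V] (v : {b : B // p ≤ deg b} → V) : (FreeOp k P B deg).M p →ₗ[k] V :=
  Finsupp.linearCombination k v

lemma FreeOp_desc_map_genOp {B : Type} {deg : B → P} {p : P} {V : Type}
    [AddCommGroup V] [Module k V] (v : {b : B // p ≤ deg b} → V) (b : B)
    (h : p ≤ deg b) :
    FreeOp_desc v ((FreeOp k P B deg).map h (genOp k P B deg b)) = v ⟨b, h⟩ := by
  rw [FreeOp_map_genOp]
  exact (Finsupp.linearCombination_single k _ _).trans (one_smul k _)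

/-- The morphism out of a free module with prescribed values on generators. -/
def FreeOp_lift {B : Type} {deg : B → P} (A : PRepOp k P) (x : ∀ b, A.M (deg b)) :
    RepOpHom (FreeOp k P B deg) A where
  f p := FreeOp_desc fun i => A.map i.2 (x i.1)
  comm {p q} h y := by
    refine LinearMap.congr_fun
      (f := (FreeOp_desc fun i => A.map i.2 (x i.1)).comp ((FreeOp k P B deg).map h))
      (g := (A.map h).comp (FreeOp_desc fun i => A.map i.2 (x i.1))) ?_ y
    refine FreeOp_lhom_ext fun b hb => ?_
    rw [LinearMap.comp_apply, LinearMap.comp_apply, PRepOp.map_trans,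
      FreeOp_desc_map_genOp, FreeOp_desc_map_genOp, PRepOp.map_trans]

lemma FreeOp_lift_map_genOp {B : Type} {deg : B → P} (A : PRepOp k P)
    (x : ∀ b, A.M (deg b)) (b : B) {p : P} (h : p ≤ deg b) :
    (FreeOp_lift A x).f p ((FreeOp k P B deg).map h (genOp k P B deg b)) =
      A.map h (x b) :=
  FreeOp_desc_map_genOp _ b h

/-- Free modules are projective. -/
lemma FreeOp_exists_lift {B : Type} {deg : B → P} {X Y : PRepOp k P}
    (φ : RepOpHom (FreeOp k P B deg) X) (ψ : RepOpHom Y X)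
    (h : ∀ p x, ∃ y, ψ.f p y = φ.f p x) :
    ∃ χ : RepOpHom (FreeOp k P B deg) Y, ∀ p x, ψ.f p (χ.f p x) = φ.f p x := by
  choose y hy using fun b => h (deg b) (genOp k P B deg b)
  refine ⟨FreeOp_lift Y y, fun p x => ?_⟩
  refine LinearMap.congr_fun (f := (ψ.f p).comp ((FreeOp_lift Y y).f p)) ?_ x
  refine FreeOp_lhom_ext fun b hb => ?_
  rw [LinearMap.comp_apply, FreeOp_lift_map_genOp, ψ.comm, φ.comm, hy]

/-- Dependent choice for sequences of varying type. -/
lemma exists_seq_of_step {α : ℕ → Type} (I : ∀ t, α t → Prop) (Q : α 0 → Prop)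
    (r : ∀ t, α t → α (t + 1) → Prop) (h0 : ∃ a, I 0 a ∧ Q a)
    (hs : ∀ t a, I t a → ∃ b, I (t + 1) b ∧ r t a b) :
    ∃ f : ∀ t, α t, Q (f 0) ∧ ∀ t, r t (f t) (f (t + 1)) := by
  choose a ha hQ using h0
  choose b hb hr using hs
  let g : ∀ t, {x : α t // I t x} := fun t =>
    Nat.rec ⟨a, ha⟩ (fun t x => ⟨b t x.1 x.2, hb t x.1 x.2⟩) t
  exact ⟨fun t => (g t).1, hQ, fun t => hr t _ (g t).2⟩

/-- Comparison of free resolutions: existence of a lift of the identity. -/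
lemma FreeRes.exists_chainMap {A : PRepOp k P} (R R' : FreeRes k P A) :
    ∃ α : ∀ t, RepOpHom (FreeOp k P (R.B t) (R.deg t)) (FreeOp k P (R'.B t) (R'.deg t)),
      (∀ p x, R'.aug.f p ((α 0).f p x) = R.aug.f p x) ∧
      ∀ t p x, (R'.d t).f p ((α (t + 1)).f p x) = (α t).f p ((R.d t).f p x) := by
  refine exists_seq_of_step
    (α := fun t => RepOpHom (FreeOp k P (R.B t) (R.deg t))
      (FreeOp k P (R'.B t) (R'.deg t)))
    (fun t a => ∀ p x, ∃ y, (R'.d t).f p y = a.f p ((R.d t).f p x))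
    (fun a => ∀ p x, R'.aug.f p (a.f p x) = R.aug.f p x)
    (fun t a b => ∀ p x, (R'.d t).f p (b.f p x) = a.f p ((R.d t).f p x)) ?_ ?_
  · obtain ⟨a, ha⟩ := FreeOp_exists_lift R.aug R'.aug fun p x => R'.aug_surj p _
    exact ⟨a, fun p x => R'.exact_aug p _ (by rw [ha, R.aug_d]), ha⟩
  · intro t a ha
    obtain ⟨b, hb⟩ := FreeOp_exists_lift (a.comp (R.d t)) (R'.d t) ha
    refine ⟨b, fun p x => R'.exact_d t p _ ?_, hb⟩
    rw [hb, RepOpHom.comp_apply, R.dd, map_zero]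

/-- Comparison of free resolutions: a chain endomorphism over the identity is
homotopic to the identity. -/
lemma FreeRes.exists_homotopy {A : PRepOp k P} (R : FreeRes k P A)
    (θ : ∀ t, RepOpHom (FreeOp k P (R.B t) (R.deg t)) (FreeOp k P (R.B t) (R.deg t)))
    (h0 : ∀ p x, R.aug.f p ((θ 0).f p x) = R.aug.f p x)
    (hθ : ∀ t p x, (R.d t).f p ((θ (t + 1)).f p x) = (θ t).f p ((R.d t).f p x)) :
    ∃ η : ∀ t, RepOpHom (FreeOp k P (R.B t) (R.deg t))
        (FreeOp k P (R.B (t + 1)) (R.deg (t + 1))),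
      (∀ p x, (R.d 0).f p ((η 0).f p x) = (θ 0).f p x - x) ∧
      ∀ t p x, (R.d (t + 1)).f p ((η (t + 1)).f p x) =
        (θ (t + 1)).f p x - x - (η t).f p ((R.d t).f p x) := by
  refine exists_seq_of_step
    (α := fun t => RepOpHom (FreeOp k P (R.B t) (R.deg t))
      (FreeOp k P (R.B (t + 1)) (R.deg (t + 1))))
    (fun t a => ∀ p x, ∃ y, (R.d (t + 1)).f p y =
      (θ (t + 1)).f p x - x - a.f p ((R.d t).f p x))
    (fun a => ∀ p x, (R.d 0).f p (a.f p x) = (θ 0).f p x - x)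
    (fun t a b => ∀ p x, (R.d (t + 1)).f p (b.f p x) =
      (θ (t + 1)).f p x - x - a.f p ((R.d t).f p x)) ?_ ?_
  · obtain ⟨a, ha⟩ := FreeOp_exists_lift ((θ 0).sub (RepOpHom.id _)) (R.d 0)
      fun p x => R.exact_aug p _ (by simp [h0])
    refine ⟨a, fun p x => R.exact_d 0 p _ ?_, ha⟩
    simp [ha, hθ]
  · intro t a ha
    obtain ⟨b, hb⟩ := FreeOp_exists_lift
      (((θ (t + 1)).sub (RepOpHom.id _)).sub (a.comp (R.d t))) (R.d (t + 1)) ha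
    refine ⟨b, fun p x => R.exact_d (t + 1) p _ ?_, hb⟩
    simp [hb, hθ, R.dd]

end Comparison

section Total

variable {k : Type} [CommRing k] {P : Type} [PartialOrder P]

lemma Mcast_dM {M : ℤ → PRep k P} (dM : ∀ s, RepHom (M s) (M (s + 1))) {p : P}
    {s s' : ℤ} (h : s = s') (h' : s + 1 = s' + 1) (x : (M s).M p) :
    (dM s').f p (Mcast h x) = Mcast h' ((dM s).f p x) := by
  subst h; rfl

lemma Mcast_map {M : ℤ → PRep k P} {p q : P} (hpq : p ≤ q)
    {s s' : ℤ} (h : s = s') (x : (M s).M p) :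
    (M s').map hpq (Mcast h x) = Mcast h ((M s).map hpq x) := by
  subst h; rfl

lemma Mcast_Mcast {M : ℤ → PRep k P} {p : P} {s s' s'' : ℤ} (h : s = s')
    (h' : s' = s'') (x : (M s).M p) :
    Mcast h' (Mcast h x) = Mcast (h.trans h') x := by
  subst h; subst h'; rfl

variable {A A' : PRepOp k P}

/-- The inclusion of a summand into the total complex, with a flexible
cohomological degree. -/
def totalOf (R : FreeRes k P A) (M : ℤ → PRep k P) {m s : ℤ} {t : ℕ}
    (hs : s = m + (t : ℤ)) (b : R.B t) :
    (M s).M (R.deg t b) →ₗ[k] ⨁ t : ℕ, TTcomp R M m t :=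
  letI := Classical.decEq ℕ
  letI := Classical.decEq (R.B t)
  (DirectSum.lof k ℕ (TTcomp R M m) t).comp
    ((DirectSum.lof k (R.B t) (fun b' => (M (m + (t : ℤ))).M (R.deg t b')) b).comp
      (Mcast hs))

/-- The class `y ⊗ n` in the total complex, for `y` in the free resolution and
`n` in `M`. -/
def totalMk (R : FreeRes k P A) (M : ℤ → PRep k P) {m s : ℤ} {t : ℕ}
    (hs : s = m + (t : ℤ)) {p : P} :
    (FreeOp k P (R.B t) (R.deg t)).M p →ₗ[k] (M s).M p →ₗ[k] ⨁ t : ℕ, TTcomp R M m t :=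
  FreeOp_desc fun i => (totalOf R M hs i.1).comp ((M s).map i.2)

lemma totalMk_eq_sum (R : FreeRes k P A) (M : ℤ → PRep k P) {m s : ℤ} {t : ℕ}
    (hs : s = m + (t : ℤ)) {p : P} (y : (FreeOp k P (R.B t) (R.deg t)).M p) :
    totalMk R M hs y = Finsupp.sum y fun i c =>
      c • (totalOf R M hs i.1).comp ((M s).map i.2) := rfl

lemma totalMk_map_genOp (R : FreeRes k P A) (M : ℤ → PRep k P) {m s : ℤ} {t : ℕ}
    (hs : s = m + (t : ℤ)) {p : P} (b : R.B t) (h : p ≤ R.deg t b) (n : (M s).M p) :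
    totalMk R M hs ((FreeOp k P _ _).map h (genOp k P _ _ b)) n =
      totalOf R M hs b ((M s).map h n) := by
  rw [totalMk, FreeOp_desc_map_genOp, LinearMap.comp_apply]

lemma totalMk_genOp (R : FreeRes k P A) (M : ℤ → PRep k P) {m s : ℤ} {t : ℕ}
    (hs : s = m + (t : ℤ)) (b : R.B t) (n : (M s).M (R.deg t b)) :
    totalMk R M hs (genOp k P _ _ b) n = totalOf R M hs b n := by
  have := totalMk_map_genOp R M hs b le_rfl n
  rwa [PRepOp.map_refl, PRep.map_refl] at this

lemma totalMk_map (R : FreeRes k P A) (M : ℤ → PRep k P) {m s : ℤ} {t : ℕ}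
    (hs : s = m + (t : ℤ)) {p q : P} (h : p ≤ q)
    (y : (FreeOp k P (R.B t) (R.deg t)).M q) (n : (M s).M p) :
    totalMk R M hs ((FreeOp k P _ _).map h y) n = totalMk R M hs y ((M s).map h n) := by
  refine LinearMap.congr_fun
    (f := (LinearMap.flip (totalMk R M hs) n).comp ((FreeOp k P _ _).map h))
    (g := LinearMap.flip (totalMk R M hs) ((M s).map h n)) ?_ y
  refine FreeOp_lhom_ext fun b hb => ?_
  simp only [LinearMap.comp_apply, LinearMap.flip_apply, PRepOp.map_trans,
    totalMk_map_genOp, PRep.map_trans]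

lemma totalMk_Mcast (R : FreeRes k P A) (M : ℤ → PRep k P) {m s s' : ℤ} {t : ℕ}
    (hs : s = m + (t : ℤ)) (h : s' = s) {p : P}
    (y : (FreeOp k P (R.B t) (R.deg t)).M p) (n : (M s').M p) :
    totalMk R M hs y (Mcast h n) = totalMk R M (h.trans hs) y n := by
  subst h
  rfl

/-- Linear maps out of the total complex agree if they agree on the classes of
generators. -/
lemma total_lhom_ext (R : FreeRes k P A) (M : ℤ → PRep k P) {m : ℤ} {V : Type}
    [AddCommGroup V] [Module k V] {f g : (⨁ t : ℕ, TTcomp R M m t) →ₗ[k] V}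
    (h : ∀ (t : ℕ) (b : R.B t) (n : (M (m + (t : ℤ))).M (R.deg t b)),
      f (totalOf R M rfl b n) = g (totalOf R M rfl b n)) : f = g := by
  let := Classical.decEq ℕ
  refine DirectSum.linearMap_ext k fun t => ?_
  let := Classical.decEq (R.B t)
  refine DirectSum.linearMap_ext k fun b => ?_
  exact LinearMap.ext fun n => h t b n

/-- The map of total complexes induced by a family of morphisms of free modules. -/
def totalMap (R : FreeRes k P A) (R' : FreeRes k P A') (M : ℤ → PRep k P) {m m' : ℤ}
    {σ : ℕ → ℕ} (hσ : ∀ t : ℕ, m + (t : ℤ) = m' + (σ t : ℤ))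
    (φ : ∀ t, RepOpHom (FreeOp k P (R.B t) (R.deg t))
      (FreeOp k P (R'.B (σ t)) (R'.deg (σ t)))) :
    (⨁ t : ℕ, TTcomp R M m t) →ₗ[k] ⨁ t : ℕ, TTcomp R' M m' t :=
  letI := Classical.decEq ℕ
  DirectSum.toModule k ℕ _ fun t =>
    letI := Classical.decEq (R.B t)
    DirectSum.toModule k (R.B t) _ fun b =>
      totalMk R' M (hσ t) ((φ t).f _ (genOp k P _ _ b))

lemma totalMap_totalOf (R : FreeRes k P A) (R' : FreeRes k P A') (M : ℤ → PRep k P)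
    {m m' : ℤ} {σ : ℕ → ℕ} (hσ : ∀ t : ℕ, m + (t : ℤ) = m' + (σ t : ℤ))
    (φ : ∀ t, RepOpHom (FreeOp k P (R.B t) (R.deg t))
      (FreeOp k P (R'.B (σ t)) (R'.deg (σ t)))) {s : ℤ} {t : ℕ} (hs : s = m + (t : ℤ))
    (b : R.B t) (n : (M s).M (R.deg t b)) :
    totalMap R R' M hσ φ (totalOf R M hs b n) =
      totalMk R' M (hs.trans (hσ t)) ((φ t).f _ (genOp k P _ _ b)) n := by
  subst hs
  simp only [totalMap, totalOf, LinearMap.comp_apply]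
  rw [DirectSum.toModule_lof, DirectSum.toModule_lof]
  rfl

lemma totalMap_totalMk (R : FreeRes k P A) (R' : FreeRes k P A') (M : ℤ → PRep k P)
    {m m' : ℤ} {σ : ℕ → ℕ} (hσ : ∀ t : ℕ, m + (t : ℤ) = m' + (σ t : ℤ))
    (φ : ∀ t, RepOpHom (FreeOp k P (R.B t) (R.deg t))
      (FreeOp k P (R'.B (σ t)) (R'.deg (σ t)))) {s : ℤ} {t : ℕ} (hs : s = m + (t : ℤ))
    {p : P} (y : (FreeOp k P (R.B t) (R.deg t)).M p) (n : (M s).M p) :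
    totalMap R R' M hσ φ (totalMk R M hs y n) =
      totalMk R' M (hs.trans (hσ t)) ((φ t).f _ y) n := by
  refine LinearMap.congr_fun
    (f := (totalMap R R' M hσ φ).comp (LinearMap.flip (totalMk R M hs) n))
    (g := (LinearMap.flip (totalMk R' M (hs.trans (hσ t))) n).comp ((φ t).f p)) ?_ y
  refine FreeOp_lhom_ext fun b hb => ?_
  simp only [LinearMap.comp_apply, LinearMap.flip_apply, RepOpHom.comm, totalMk_map,
    totalMk_genOp, totalMap_totalOf]

variable (R : FreeRes k P A) (M : ℤ → PRep k P) (dM : ∀ s, RepHom (M s) (M (s + 1)))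

lemma ttA_lof {m s : ℤ} {t : ℕ} (hs : s = m + (t : ℤ)) (b : R.B t)
    (n : (M s).M (R.deg t b)) :
    letI := Classical.decEq ℕ
    letI := Classical.decEq (R.B t)
    DirectSum.lof k ℕ (TTcomp R M (m + 1)) t (ttA R M dM m t
      (DirectSum.lof k (R.B t) (fun b' => (M (m + (t : ℤ))).M (R.deg t b')) b
        (Mcast hs n))) =
      (-1 : k) ^ t • totalOf R M (show s + 1 = (m + 1) + (t : ℤ) by lia) b
        ((dM s).f _ n) := by
  subst hs
  simp only [ttA, totalOf, DirectSum.toModule_lof, LinearMap.comp_apply,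
    LinearMap.smul_apply, map_smul]
  rfl

lemma ttB_lof {m s : ℤ} {t : ℕ} (hs : s = m + ((t + 1 : ℕ) : ℤ)) (b : R.B (t + 1))
    (n : (M s).M (R.deg (t + 1) b)) :
    letI := Classical.decEq ℕ
    letI := Classical.decEq (R.B (t + 1))
    DirectSum.lof k ℕ (TTcomp R M (m + 1)) t (ttB R M m t
      (DirectSum.lof k (R.B (t + 1))
        (fun b' => (M (m + ((t + 1 : ℕ) : ℤ))).M (R.deg (t + 1) b')) b
        (Mcast hs n))) =
      totalMk R M (show s = (m + 1) + (t : ℤ) by lia)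
        ((R.d t).f _ (genOp k P _ _ b)) n := by
  subst hs
  simp only [ttB, DirectSum.toModule_lof]
  rw [totalMk_eq_sum]
  simp only [Finsupp.sum, LinearMap.sum_apply, map_sum, LinearMap.smul_apply, map_smul]
  rfl

/-- The differential of the total complex, as a map of direct sums. -/
def totalD (m : ℤ) :
    (⨁ t : ℕ, TTcomp R M m t) →ₗ[k] ⨁ t : ℕ, TTcomp R M (m + 1) t :=
  (TotalTensor R M dM).d m

lemma totalD_totalOf_zero {m s : ℤ} (hs : s = m + ((0 : ℕ) : ℤ)) (b : R.B 0)
    (n : (M s).M (R.deg 0 b)) :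
    totalD R M dM m (totalOf R M hs b n) =
      totalOf R M (show s + 1 = (m + 1) + ((0 : ℕ) : ℤ) by lia) b ((dM s).f _ n) := by
  have h := ttA_lof R M dM hs b n
  simp only [totalD, TotalTensor, totalOf, LinearMap.comp_apply] at h ⊢
  erw [DirectSum.toModule_lof]
  rw [LinearMap.add_apply, LinearMap.comp_apply, h]
  simp

lemma totalD_totalOf_succ {m s : ℤ} {t : ℕ} (hs : s = m + ((t + 1 : ℕ) : ℤ))
    (b : R.B (t + 1)) (n : (M s).M (R.deg (t + 1) b)) :
    totalD R M dM m (totalOf R M hs b n) =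
      (-1 : k) ^ (t + 1) •
        totalOf R M (show s + 1 = (m + 1) + ((t + 1 : ℕ) : ℤ) by lia) b ((dM s).f _ n) +
      totalMk R M (show s = (m + 1) + (t : ℤ) by lia)
        ((R.d t).f _ (genOp k P _ _ b)) n := by
  have h := ttA_lof R M dM hs b n
  have h' := ttB_lof R M hs b n
  simp only [totalD, TotalTensor, totalOf, LinearMap.comp_apply] at h h' ⊢
  erw [DirectSum.toModule_lof]
  rw [LinearMap.add_apply, LinearMap.comp_apply, LinearMap.comp_apply, h, h']

lemma totalD_totalMk_zero {m s : ℤ} (hs : s = m + ((0 : ℕ) : ℤ)) {p : P}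
    (y : (FreeOp k P (R.B 0) (R.deg 0)).M p) (n : (M s).M p) :
    totalD R M dM m (totalMk R M hs y n) =
      totalMk R M (show s + 1 = (m + 1) + ((0 : ℕ) : ℤ) by lia) y ((dM s).f _ n) := by
  refine LinearMap.congr_fun
    (f := (totalD R M dM m).comp (LinearMap.flip (totalMk R M hs) n))
    (g := LinearMap.flip
      (totalMk R M (show s + 1 = (m + 1) + ((0 : ℕ) : ℤ) by lia)) ((dM s).f _ n)) ?_ y
  refine FreeOp_lhom_ext fun b hb => ?_
  simp only [LinearMap.comp_apply, LinearMap.flip_apply, totalMk_map, totalMk_genOp,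
    totalD_totalOf_zero, RepHom.comm]

lemma totalD_totalMk_succ {m s : ℤ} {t : ℕ} (hs : s = m + ((t + 1 : ℕ) : ℤ)) {p : P}
    (y : (FreeOp k P (R.B (t + 1)) (R.deg (t + 1))).M p) (n : (M s).M p) :
    totalD R M dM m (totalMk R M hs y n) =
      (-1 : k) ^ (t + 1) •
        totalMk R M (show s + 1 = (m + 1) + ((t + 1 : ℕ) : ℤ) by lia) y ((dM s).f _ n) +
      totalMk R M (show s = (m + 1) + (t : ℤ) by lia) ((R.d t).f _ y) n := by
  refine LinearMap.congr_fun
    (f := (totalD R M dM m).comp (LinearMap.flip (totalMk R M hs) n))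
    (g := (-1 : k) ^ (t + 1) • LinearMap.flip
        (totalMk R M (show s + 1 = (m + 1) + ((t + 1 : ℕ) : ℤ) by lia)) ((dM s).f _ n) +
      (LinearMap.flip (totalMk R M (show s = (m + 1) + (t : ℤ) by lia)) n).comp
        ((R.d t).f p)) ?_ y
  refine FreeOp_lhom_ext fun b hb => ?_
  simp only [LinearMap.comp_apply, LinearMap.flip_apply, LinearMap.add_apply,
    LinearMap.smul_apply, totalMk_map, totalMk_genOp, RepOpHom.comm,
    totalD_totalOf_succ, RepHom.comm]

lemma totalMap_comp {A'' : PRepOp k P} (R' : FreeRes k P A') (R'' : FreeRes k P A'')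
    (φ : ∀ t, RepOpHom (FreeOp k P (R.B t) (R.deg t)) (FreeOp k P (R'.B t) (R'.deg t)))
    (ψ : ∀ t, RepOpHom (FreeOp k P (R'.B t) (R'.deg t))
      (FreeOp k P (R''.B t) (R''.deg t))) (m : ℤ) (x : ⨁ t : ℕ, TTcomp R M m t) :
    totalMap R' R'' M (σ := fun t => t) (m' := m) (fun _ => rfl) ψ
        (totalMap R R' M (σ := fun t => t) (fun _ => rfl) φ x) =
      totalMap R R'' M (σ := fun t => t) (fun _ => rfl) (fun t => (ψ t).comp (φ t)) x := by
  refine LinearMap.congr_fun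
    (f := (totalMap R' R'' M (σ := fun t => t) (fun _ => rfl) ψ).comp
      (totalMap R R' M (σ := fun t => t) (fun _ => rfl) φ))
    (g := totalMap R R'' M (σ := fun t => t) (fun _ => rfl)
      (fun t => (ψ t).comp (φ t))) ?_ x
  refine total_lhom_ext R M fun t b n => ?_
  simp only [LinearMap.comp_apply, ← totalMk_genOp, totalMap_totalMk, RepOpHom.comp_apply]

/-- A chain map of resolutions induces a chain map of total complexes. -/
lemma totalMap_d (R' : FreeRes k P A')
    (φ : ∀ t, RepOpHom (FreeOp k P (R.B t) (R.deg t)) (FreeOp k P (R'.B t) (R'.deg t)))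
    (hφ : ∀ t p x, (R'.d t).f p ((φ (t + 1)).f p x) = (φ t).f p ((R.d t).f p x)) :
    ∀ m x, totalMap R R' M (σ := fun t => t) (fun _ => rfl) φ (totalD R M dM m x) =
      totalD R' M dM m (totalMap R R' M (σ := fun t => t) (fun _ => rfl) φ x) := by
  intro m x
  refine LinearMap.congr_fun
    (f := (totalMap R R' M (σ := fun t => t) (fun _ => rfl) φ).comp
      (totalD R M dM m))
    (g := (totalD R' M dM m).comp
      (totalMap R R' M (σ := fun t => t) (fun _ => rfl) φ)) ?_ x
  refine total_lhom_ext R M fun t b n => ?_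
  simp only [LinearMap.comp_apply, ← totalMk_genOp]
  cases t with
  | zero =>
    rw [totalD_totalMk_zero, totalMap_totalMk, totalMap_totalMk, totalD_totalMk_zero]
  | succ t =>
    rw [totalD_totalMk_succ, map_add, map_smul, totalMap_totalMk, totalMap_totalMk,
      totalMap_totalMk, totalD_totalMk_succ, hφ]

lemma total_neg_smul {m : ℤ} (c : k) (x : ⨁ t : ℕ, TTcomp R M m t) :
    (-c) • x = -(c • x) := neg_smul c x

/-- A homotopy of resolutions induces a homotopy of total complexes. -/
lemma totalMap_homotopy
    (θ : ∀ t, RepOpHom (FreeOp k P (R.B t) (R.deg t)) (FreeOp k P (R.B t) (R.deg t)))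
    (η : ∀ t, RepOpHom (FreeOp k P (R.B t) (R.deg t))
      (FreeOp k P (R.B (t + 1)) (R.deg (t + 1))))
    (h0 : ∀ p x, (R.d 0).f p ((η 0).f p x) = (θ 0).f p x - x)
    (hη : ∀ t p x, (R.d (t + 1)).f p ((η (t + 1)).f p x) =
      (θ (t + 1)).f p x - x - (η t).f p ((R.d t).f p x)) :
    ∃ h : ∀ m, (⨁ t : ℕ, TTcomp R M (m + 1) t) →ₗ[k] ⨁ t : ℕ, TTcomp R M m t,
      ∀ m x, totalMap R R M (σ := fun t => t) (fun _ => rfl) θ x =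
        x + totalD R M dM m (h m x) +
          h (m + 1) (totalD R M dM (m + 1) x) := by
  let h : ∀ m, (⨁ t : ℕ, TTcomp R M (m + 1) t) →ₗ[k] ⨁ t : ℕ, TTcomp R M m t :=
    fun m => totalMap R R M (m := m + 1) (m' := m) (σ := fun t => t + 1)
      (fun t => by push_cast; ring) η
  refine ⟨h, fun m x => ?_⟩
  refine LinearMap.congr_fun
    (f := totalMap R R M (σ := fun t => t) (fun _ => rfl) θ)
    (g := LinearMap.id + (totalD R M dM m).comp (h m) +
      (h (m + 1)).comp (totalD R M dM (m + 1))) ?_ x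
  refine total_lhom_ext R M fun t b n => ?_
  simp only [LinearMap.comp_apply, LinearMap.add_apply, LinearMap.id_apply,
    ← totalMk_genOp, h]
  rw [totalMap_totalMk, totalMap_totalMk, totalD_totalMk_succ]
  cases t with
  | zero =>
    rw [totalD_totalMk_zero, totalMap_totalMk, h0]
    simp only [map_sub, LinearMap.sub_apply, zero_add, pow_one, total_neg_smul,
      one_smul]
    abel
  | succ t =>
    rw [totalD_totalMk_succ, map_add, map_smul, totalMap_totalMk, totalMap_totalMk, hη]
    simp only [map_sub, LinearMap.sub_apply, pow_succ (-1 : k) (t + 1), mul_neg_one,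
      total_neg_smul]
    abel

end Total

section Cofiber

variable {k : Type} [CommRing k] {P : Type} [PartialOrder P] [OrderTop P]

/-- `kStarVal` as a linear map. -/
def kStarValHom (p : P) : (kStar k P).M p →ₗ[k] k := Submodule.subtype _

lemma kStarVal_injective {p : P} {x y : (kStar k P).M p} (h : kStarVal x = kStarVal y) :
    x = y := Subtype.ext h

lemma kStarVal_zero {p : P} : kStarVal (0 : (kStar k P).M p) = 0 := rfl

lemma kStarVal_top (x : (kStar k P).M ⊤) : kStarVal x = 0 := x.2 rfl

/-- The coefficient of an element of the free module `kP̂(−, 1̂)`. -/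
def topCoeff (p : P) : (FreeOp k P Unit (fun _ => ⊤)).M p →ₗ[k] k :=
  FreeOp_desc fun _ => 1

/-- The element of `kP̂(−, 1̂)` with a given coefficient. -/
def topElem (p : P) : k →ₗ[k] (FreeOp k P Unit (fun _ => ⊤)).M p :=
  LinearMap.toSpanSingleton k _
    ((FreeOp k P Unit (fun _ => ⊤)).map le_top (genOp k P Unit (fun _ => ⊤) ()))

@[simp] lemma topCoeff_topElem (p : P) (c : k) : topCoeff p (topElem p c) = c := by
  rw [topElem, LinearMap.toSpanSingleton_apply, map_smul, topCoeff, FreeOp_desc_map_genOp]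
  simp

@[simp] lemma topElem_topCoeff (p : P) (x : (FreeOp k P Unit (fun _ => ⊤)).M p) :
    topElem p (topCoeff p x) = x := by
  refine LinearMap.congr_fun (f := (topElem p).comp (topCoeff p)) (g := LinearMap.id) ?_ x
  refine FreeOp_lhom_ext fun b hb => ?_
  rw [LinearMap.comp_apply, topCoeff, FreeOp_desc_map_genOp, topElem,
    LinearMap.toSpanSingleton_apply, one_smul]
  rfl

lemma topElem_map {p q : P} (h : p ≤ q) (c : k) :
    (FreeOp k P Unit (fun _ => ⊤)).map h (topElem q c) = topElem p c := by
  rw [topElem, topElem, LinearMap.toSpanSingleton_apply, LinearMap.toSpanSingleton_apply,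
    map_smul, PRepOp.map_trans]

lemma topCoeff_map {p q : P} (h : p ≤ q) (x : (FreeOp k P Unit (fun _ => ⊤)).M q) :
    topCoeff p ((FreeOp k P Unit (fun _ => ⊤)).map h x) = topCoeff q x := by
  obtain ⟨c, rfl⟩ : ∃ c, topElem q c = x := ⟨_, topElem_topCoeff q x⟩
  rw [topElem_map, topCoeff_topElem, topCoeff_topElem]

/-- The inclusion `k{*}_P → kP̂(−, 1̂)`. -/
def kStarToTop : RepOpHom (kStar k P) (FreeOp k P Unit (fun _ => ⊤)) where
  f p := (topElem p).comp (kStarValHom p)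
  comm h _ := (topElem_map h _).symm

open Classical in
/-- The projection `kP̂(−, 1̂) → S_{1̂}`. -/
def topToSimple : RepOpHom (FreeOp k P Unit (fun _ => ⊤)) (SimpleOp k P ⊤ k) where
  f p := LinearMap.codRestrict (diagSubmodule k P p ⊤ k)
    (if p = ⊤ then topCoeff p else 0) (fun _ h => by simp [h])
  comm {p q} h x := by
    refine Subtype.ext ?_
    show (if p = ⊤ then topCoeff p else 0) _ =
      if p = q then (if q = ⊤ then topCoeff q else 0) x else 0
    by_cases hp : p = ⊤
    · have hq : q = ⊤ := top_unique (hp ▸ h)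
      subst hq
      simp only [hp, if_true]
      exact topCoeff_map h x
    · by_cases hpq : p = q
      · simp [hpq, hpq ▸ hp]
      · simp [hp, hpq]

open Classical in
lemma topToSimple_eq_zero_iff {p : P} (x : (FreeOp k P Unit (fun _ => ⊤)).M p) :
    topToSimple.f p x = 0 ↔ (p = ⊤ → topCoeff p x = 0) := by
  refine Subtype.ext_iff.trans ?_
  show (if p = ⊤ then topCoeff p else 0) x = 0 ↔ _
  by_cases hp : p = ⊤ <;> simp [hp]

open Classical in
lemma topToSimple_surjective (p : P) : Function.Surjective (topToSimple (k := k).f p) := by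
  intro x
  refine ⟨topElem p x.1, Subtype.ext ?_⟩
  show (if p = ⊤ then topCoeff p else 0) _ = x.1
  by_cases hp : p = ⊤
  · simp [hp]
  · simp [hp, x.2 hp]

variable (G : FreeRes k P (kStar k P))

/-- The bases of the cone of `G → kP̂(−, 1̂)`. -/
def cofiberB : ℕ → Type
  | 0 => Unit
  | t + 1 => G.B t

/-- The degrees of the basis elements of the cone of `G → kP̂(−, 1̂)`. -/
def cofiberDeg : ∀ t, cofiberB G t → P
  | 0 => fun _ => ⊤
  | t + 1 => G.deg t

/-- The differential of the cone of `G → kP̂(−, 1̂)`. -/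
def cofiberD : ∀ t, RepOpHom (FreeOp k P (cofiberB G (t + 1)) (cofiberDeg G (t + 1)))
    (FreeOp k P (cofiberB G t) (cofiberDeg G t))
  | 0 => kStarToTop.comp G.aug
  | t + 1 => (G.d t).neg

lemma cofiberD_zero_eq_zero_iff {p : P}
    (x : (FreeOp k P (G.B 0) (G.deg 0)).M p) :
    (cofiberD G 0).f p x = 0 ↔ G.aug.f p x = 0 := by
  constructor
  · intro h
    have := congrArg (topCoeff p) h
    refine kStarVal_injective ?_
    exact (topCoeff_topElem p _).symm.trans (this.trans (map_zero _))
  · intro h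
    show kStarToTop.f p (G.aug.f p x) = 0
    rw [h, map_zero]

/-- The cone of `G → kP̂(−, 1̂)` is a free resolution of `S_{1̂}`. -/
def cofiberRes : FreeRes k P (SimpleOp k P ⊤ k) where
  B := cofiberB G
  deg := cofiberDeg G
  d := cofiberD G
  aug := topToSimple
  aug_surj := topToSimple_surjective
  aug_d p x := by
    refine (topToSimple_eq_zero_iff _).2 fun hp => ?_
    subst hp
    exact (topCoeff_topElem _ _).trans (kStarVal_top _)
  dd t p x := by
    cases t with
    | zero =>
      refine (cofiberD_zero_eq_zero_iff G _).2 ?_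
      exact (map_neg (G.aug.f p) _).trans (neg_eq_zero.2 (G.aug_d p x))
    | succ t =>
      show -(G.d t).f p (-(G.d (t + 1)).f p x) = 0
      rw [map_neg, neg_neg]
      exact G.dd t p x
  exact_aug p x hx := by
    have hx' := (topToSimple_eq_zero_iff _).1 hx
    obtain ⟨y, hy⟩ := G.aug_surj p ⟨topCoeff p x, hx'⟩
    refine ⟨y, ?_⟩
    show topElem p (kStarVal (G.aug.f p y)) = x
    rw [hy]
    exact topElem_topCoeff p x
  exact_d t p x hx := by
    cases t with
    | zero =>
      obtain ⟨y, hy⟩ := G.exact_aug p x ((cofiberD_zero_eq_zero_iff G _).1 hx)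
      exact ⟨-y, (map_neg (-(G.d 0).f p) y).trans ((neg_neg _).trans hy)⟩
    | succ t =>
      obtain ⟨y, hy⟩ := G.exact_d t p x (neg_eq_zero.1 hx)
      exact ⟨-y, (map_neg (-(G.d (t + 1)).f p) y).trans ((neg_neg _).trans hy)⟩

variable (M : ℤ → PRep k P) (dM : ∀ s, RepHom (M s) (M (s + 1)))

/-- `augToTop`, as a map out of a direct sum. -/
def totalAug (m : ℤ) : (⨁ t : ℕ, TTcomp G M m t) →ₗ[k] (M m).M ⊤ :=
  augToTop G M dM m

lemma totalAug_totalOf_zero {m s : ℤ} (hs : s = m + ((0 : ℕ) : ℤ)) (b : G.B 0)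
    (n : (M s).M (G.deg 0 b)) :
    totalAug G M dM m (totalOf G M hs b n) =
      kStarVal (G.aug.f _ (genOp k P _ _ b)) •
        (M m).map le_top (Mcast (show s = m by simpa using hs) n) := by
  simp only [totalAug, augToTop, totalOf, LinearMap.comp_apply]
  erw [DirectSum.toModule_lof, DirectSum.toModule_lof]
  exact congrArg
    (fun x => kStarVal (G.aug.f _ (genOp k P _ _ b)) • (M m).map le_top x) (Mcast_Mcast _ _ n)

lemma totalAug_totalMk_zero {m s : ℤ} (hs : s = m + ((0 : ℕ) : ℤ)) {p : P}
    (y : (FreeOp k P (G.B 0) (G.deg 0)).M p) (n : (M s).M p) :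
    totalAug G M dM m (totalMk G M hs y n) =
      kStarVal (G.aug.f _ y) •
        (M m).map le_top (Mcast (show s = m by simpa using hs) n) := by
  refine LinearMap.congr_fun
    (f := (totalAug G M dM m).comp (LinearMap.flip (totalMk G M hs) n))
    (g := (LinearMap.toSpanSingleton k _
      ((M m).map le_top (Mcast (show s = m by simpa using hs) n))).comp
        ((kStarValHom p).comp (G.aug.f p))) ?_ y
  refine FreeOp_lhom_ext fun b hb => ?_
  simp only [LinearMap.comp_apply, LinearMap.flip_apply, totalMk_map, totalMk_genOp,
    totalAug_totalOf_zero, ← Mcast_map, PRep.map_trans, G.aug.comm,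
    LinearMap.toSpanSingleton_apply]
  rfl

lemma totalAug_totalMk_succ {m s : ℤ} {t : ℕ} (hs : s = m + ((t + 1 : ℕ) : ℤ)) {p : P}
    (y : (FreeOp k P (G.B (t + 1)) (G.deg (t + 1))).M p) (n : (M s).M p) :
    totalAug G M dM m (totalMk G M hs y n) = 0 := by
  refine LinearMap.congr_fun
    (f := (totalAug G M dM m).comp (LinearMap.flip (totalMk G M hs) n)) (g := 0) ?_ y
  refine FreeOp_lhom_ext fun b hb => ?_
  simp only [LinearMap.comp_apply, LinearMap.flip_apply, totalMk_map, totalMk_genOp]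
  simp only [totalAug, augToTop, totalOf, LinearMap.comp_apply]
  erw [DirectSum.toModule_lof]
  rfl

lemma totalAug_totalD (m : ℤ) (x : ⨁ t : ℕ, TTcomp G M m t) :
    totalAug G M dM (m + 1) (totalD G M dM m x) = (dM m).f ⊤ (totalAug G M dM m x) := by
  refine LinearMap.congr_fun
    (f := (totalAug G M dM (m + 1)).comp (totalD G M dM m))
    (g := ((dM m).f ⊤).comp (totalAug G M dM m)) ?_ x
  refine total_lhom_ext G M fun t b n => ?_
  simp only [LinearMap.comp_apply, ← totalMk_genOp]
  match t with
  | 0 =>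
    rw [totalD_totalMk_zero, totalAug_totalMk_zero, totalAug_totalMk_zero, map_smul,
      (dM m).comm, Mcast_dM]
  | 1 =>
    rw [totalD_totalMk_succ, map_add, map_smul, totalAug_totalMk_succ,
      totalAug_totalMk_succ, totalAug_totalMk_zero, G.aug_d]
    simp [kStarVal_zero]
  | t + 2 =>
    rw [totalD_totalMk_succ, map_add, map_smul, totalAug_totalMk_succ,
      totalAug_totalMk_succ, totalAug_totalMk_succ]
    simp

/-- The inclusion of `G`, shifted, into the cone of `G → kP̂(−, 1̂)`. -/
def cofiberShift (t : ℕ) : RepOpHom (FreeOp k P (G.B t) (G.deg t))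
    (FreeOp k P ((cofiberRes G).B (t + 1)) ((cofiberRes G).deg (t + 1))) where
  f _ := LinearMap.id
  comm _ _ := rfl

/-- The projection of the cone of `G → kP̂(−, 1̂)` onto the shift of `G`. -/
def cofiberUnshift (t : ℕ) : RepOpHom
    (FreeOp k P ((cofiberRes G).B (t + 1)) ((cofiberRes G).deg (t + 1)))
    (FreeOp k P (G.B t) (G.deg t)) where
  f _ := LinearMap.id
  comm _ _ := rfl

/-- The coefficient of an element of the degree zero term of the cone of
`G → kP̂(−, 1̂)`. -/
def cofiberCoeff (p : P) :
    (FreeOp k P ((cofiberRes G).B 0) ((cofiberRes G).deg 0)).M p →ₗ[k] k :=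
  topCoeff p

/-- The comparison of the total complex of the cone of `G → kP̂(−, 1̂)` with the cone
of `augToTop`. -/
def totalToCone (m : ℤ) : (⨁ t : ℕ, TTcomp (cofiberRes G) M m t) →ₗ[k]
    (⨁ t : ℕ, TTcomp G M (m + 1) t) × (M m).M ⊤ :=
  letI := Classical.decEq ℕ
  DirectSum.toModule k ℕ _ fun t =>
    match t with
    | 0 =>
      letI := Classical.decEq ((cofiberRes G).B 0)
      (LinearMap.inr k _ _).comp
        (DirectSum.toModule k ((cofiberRes G).B 0) _ fun _ =>
          ((M m).map le_top).comp (Mcast (show m + ((0 : ℕ) : ℤ) = m by simp)))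
    | t + 1 =>
      letI := Classical.decEq ((cofiberRes G).B (t + 1))
      (LinearMap.inl k _ _).comp
        (DirectSum.toModule k ((cofiberRes G).B (t + 1)) _ fun b =>
          totalMk G M (show m + ((t + 1 : ℕ) : ℤ) = (m + 1) + (t : ℤ) by push_cast; ring)
            ((cofiberUnshift G t).f _ (genOp k P _ _ b)))

lemma totalToCone_totalOf_zero {m s : ℤ} (hs : s = m + ((0 : ℕ) : ℤ))
    (b : (cofiberRes G).B 0) (n : (M s).M ((cofiberRes G).deg 0 b)) :
    totalToCone G M m (totalOf (cofiberRes G) M hs b n) =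
      (0, (M m).map le_top (Mcast (show s = m by simpa using hs) n)) := by
  simp only [totalToCone, totalOf, LinearMap.comp_apply]
  rw [DirectSum.toModule_lof, LinearMap.comp_apply]
  erw [DirectSum.toModule_lof]
  rw [LinearMap.inr_apply, LinearMap.comp_apply, Mcast_Mcast]

lemma totalToCone_totalMk_zero {m s : ℤ} (hs : s = m + ((0 : ℕ) : ℤ)) {p : P}
    (y : (FreeOp k P ((cofiberRes G).B 0) ((cofiberRes G).deg 0)).M p) (n : (M s).M p) :
    totalToCone G M m (totalMk (cofiberRes G) M hs y n) =
      (0, cofiberCoeff G p y •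
        (M m).map le_top (Mcast (show s = m by simpa using hs) n)) := by
  refine LinearMap.congr_fun
    (f := (totalToCone G M m).comp (LinearMap.flip (totalMk (cofiberRes G) M hs) n))
    (g := (LinearMap.inr k _ _).comp ((LinearMap.toSpanSingleton k _
      ((M m).map le_top (Mcast (show s = m by simpa using hs) n))).comp
        (cofiberCoeff G p))) ?_ y
  refine FreeOp_lhom_ext fun b hb => ?_
  simp only [LinearMap.comp_apply, LinearMap.flip_apply, totalMk_map, totalMk_genOp,
    totalToCone_totalOf_zero, ← Mcast_map, PRep.map_trans,
    LinearMap.toSpanSingleton_apply, LinearMap.inr_apply]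
  have h : cofiberCoeff G p ((FreeOp k P _ _).map hb (genOp k P _ _ b)) = 1 :=
    FreeOp_desc_map_genOp _ _ _
  rw [h, one_smul]

lemma totalToCone_totalOf_succ {m s : ℤ} {t : ℕ} (hs : s = m + ((t + 1 : ℕ) : ℤ))
    (b : (cofiberRes G).B (t + 1)) (n : (M s).M ((cofiberRes G).deg (t + 1) b)) :
    totalToCone G M m (totalOf (cofiberRes G) M hs b n) =
      (totalMk G M (show s = (m + 1) + (t : ℤ) by lia)
        ((cofiberUnshift G t).f _ (genOp k P _ _ b)) n, 0) := by
  subst hs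
  simp only [totalToCone, totalOf, LinearMap.comp_apply]
  rw [DirectSum.toModule_lof, LinearMap.comp_apply]
  erw [DirectSum.toModule_lof]
  rfl

lemma totalToCone_totalMk_succ {m s : ℤ} {t : ℕ} (hs : s = m + ((t + 1 : ℕ) : ℤ)) {p : P}
    (y : (FreeOp k P ((cofiberRes G).B (t + 1)) ((cofiberRes G).deg (t + 1))).M p)
    (n : (M s).M p) :
    totalToCone G M m (totalMk (cofiberRes G) M hs y n) =
      (totalMk G M (show s = (m + 1) + (t : ℤ) by lia) ((cofiberUnshift G t).f p y) n,
        0) := by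
  refine LinearMap.congr_fun
    (f := (totalToCone G M m).comp (LinearMap.flip (totalMk (cofiberRes G) M hs) n))
    (g := (LinearMap.inl k _ _).comp ((LinearMap.flip
      (totalMk G M (show s = (m + 1) + (t : ℤ) by lia)) n).comp
        ((cofiberUnshift G t).f p))) ?_ y
  refine FreeOp_lhom_ext fun b hb => ?_
  simp only [LinearMap.comp_apply, LinearMap.flip_apply, totalMk_map, totalMk_genOp,
    totalToCone_totalOf_succ, LinearMap.inl_apply, RepOpHom.comm]

lemma totalToCone_totalD (m : ℤ) (x : ⨁ t : ℕ, TTcomp (cofiberRes G) M m t) :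
    totalToCone G M (m + 1) (totalD (cofiberRes G) M dM m x) =
      (-totalD G M dM (m + 1) (totalToCone G M m x).1,
        totalAug G M dM (m + 1) (totalToCone G M m x).1 +
          (dM m).f ⊤ (totalToCone G M m x).2) := by
  refine LinearMap.congr_fun
    (f := (totalToCone G M (m + 1)).comp (totalD (cofiberRes G) M dM m))
    (g := (LinearMap.prod (-(totalD G M dM (m + 1)).comp (LinearMap.fst k _ _))
      ((totalAug G M dM (m + 1)).comp (LinearMap.fst k _ _) +
        ((dM m).f ⊤).comp (LinearMap.snd k _ _))).comp (totalToCone G M m)) ?_ x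
  refine total_lhom_ext _ M fun t b n => ?_
  simp only [LinearMap.comp_apply, ← totalMk_genOp, LinearMap.prod_apply,
    Function.prod, LinearMap.add_apply, LinearMap.neg_apply, LinearMap.fst_apply,
    LinearMap.snd_apply]
  match t with
  | 0 =>
    rw [totalD_totalMk_zero, totalToCone_totalMk_zero, totalToCone_totalMk_zero]
    simp only [map_zero, neg_zero, zero_add, map_smul, (dM m).comm]
    rw [Mcast_dM]
  | 1 =>
    rw [totalD_totalMk_succ, map_add, map_smul, totalToCone_totalMk_succ,
      totalToCone_totalMk_succ, totalToCone_totalMk_zero]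
    simp only [totalD_totalMk_zero, totalAug_totalMk_zero]
    have h : cofiberCoeff G _ (((cofiberRes G).d 0).f _ (genOp k P _ _ b)) =
      kStarVal (G.aug.f _ ((cofiberUnshift G 0).f _ (genOp k P _ _ b))) :=
      topCoeff_topElem _ _
    rw [h]
    ext1
    · simp [total_neg_smul]
    · simp
  | t + 2 =>
    rw [totalD_totalMk_succ, map_add, map_smul, totalToCone_totalMk_succ,
      totalToCone_totalMk_succ, totalToCone_totalMk_succ]
    simp only [totalD_totalMk_succ, totalAug_totalMk_succ]
    have h : (cofiberUnshift G t).f _ (((cofiberRes G).d (t + 1)).f _ (genOp k P _ _ b)) =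
      -(G.d t).f _ ((cofiberUnshift G (t + 1)).f _ (genOp k P _ _ b)) := rfl
    rw [h, map_neg, pow_succ (-1 : k) (t + 1), mul_neg_one, LinearMap.neg_apply,
      Prod.smul_mk, Prod.mk_add_mk, smul_zero, add_zero, map_zero, add_zero,
      total_neg_smul, neg_add]

/-- The generator of the degree zero term of the cone of `G → kP̂(−, 1̂)`. -/
def cofiberGen : (FreeOp k P ((cofiberRes G).B 0) ((cofiberRes G).deg 0)).M ⊤ :=
  genOp k P Unit (fun _ => ⊤) ()

lemma cofiberCoeff_cofiberGen : cofiberCoeff G ⊤ (cofiberGen G) = 1 := by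
  have := FreeOp_desc_map_genOp (k := k) (deg := fun _ : Unit => (⊤ : P))
    (p := ⊤) (fun _ => (1 : k)) () le_rfl
  rwa [PRepOp.map_refl] at this

lemma cofiberCoeff_smul_map_cofiberGen {p : P}
    (y : (FreeOp k P ((cofiberRes G).B 0) ((cofiberRes G).deg 0)).M p) :
    cofiberCoeff G p y • (FreeOp k P ((cofiberRes G).B 0) ((cofiberRes G).deg 0)).map
      le_top (cofiberGen G) = y :=
  topElem_topCoeff p y

/-- The inverse of `totalToCone`. -/
def coneToTotal (m : ℤ) : (⨁ t : ℕ, TTcomp G M (m + 1) t) × (M m).M ⊤ →ₗ[k]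
    ⨁ t : ℕ, TTcomp (cofiberRes G) M m t :=
  LinearMap.coprod
    (totalMap G (cofiberRes G) M (σ := fun t => t + 1)
      (fun t => by push_cast; ring) (cofiberShift G))
    (totalMk (cofiberRes G) M (show m = m + ((0 : ℕ) : ℤ) by simp) (cofiberGen G))

lemma totalToCone_coneToTotal (m : ℤ)
    (x : (⨁ t : ℕ, TTcomp G M (m + 1) t) × (M m).M ⊤) :
    totalToCone G M m (coneToTotal G M m x) = x := by
  refine LinearMap.congr_fun (f := (totalToCone G M m).comp (coneToTotal G M m))
    (g := LinearMap.id) ?_ x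
  refine LinearMap.prod_ext ?_ ?_
  · refine total_lhom_ext _ M fun t b n => ?_
    simp only [LinearMap.comp_apply, LinearMap.inl_apply, coneToTotal,
      LinearMap.coprod_apply, map_zero, add_zero, ← totalMk_genOp, totalMap_totalMk,
      totalToCone_totalMk_succ, LinearMap.id_apply]
    rfl
  · refine LinearMap.ext fun n => ?_
    simp only [LinearMap.comp_apply, LinearMap.inr_apply, coneToTotal,
      LinearMap.coprod_apply, map_zero, zero_add, LinearMap.id_apply]
    rw [totalToCone_totalMk_zero, cofiberCoeff_cofiberGen, one_smul]
    exact congrArg _ ((M m).map_refl ⊤ n)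

lemma coneToTotal_totalToCone (m : ℤ) (x : ⨁ t : ℕ, TTcomp (cofiberRes G) M m t) :
    coneToTotal G M m (totalToCone G M m x) = x := by
  refine LinearMap.congr_fun (f := (coneToTotal G M m).comp (totalToCone G M m))
    (g := LinearMap.id) ?_ x
  refine total_lhom_ext _ M fun t b n => ?_
  rw [LinearMap.comp_apply, LinearMap.id_apply, ← totalMk_genOp]
  cases t with
  | zero =>
    rw [totalToCone_totalMk_zero, coneToTotal, LinearMap.coprod_apply, map_zero, zero_add,
      Mcast_map, map_smul, totalMk_Mcast, ← totalMk_map, ← LinearMap.smul_apply,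
      ← map_smul, cofiberCoeff_smul_map_cofiberGen]
  | succ t =>
    rw [totalToCone_totalMk_succ, coneToTotal, LinearMap.coprod_apply, map_zero, add_zero,
      totalMap_totalMk]
    rfl

end Cofiber

section Homotopy

variable {k : Type} [CommRing k] {C D E : ZComplex k}

/-- A chain map which is a homotopy equivalence. -/
def IsHomotopyEquiv (f : ∀ m, C.X m →ₗ[k] D.X m) : Prop :=
  IsChainMap f ∧ ∃ g : ∀ m, D.X m →ₗ[k] C.X m, IsChainMap g ∧
    (∃ u : ∀ m, C.X (m + 1) →ₗ[k] C.X m, ∀ m x,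
      g (m + 1) (f (m + 1) x) = x + C.d m (u m x) + u (m + 1) (C.d (m + 1) x)) ∧
    ∃ v : ∀ m, D.X (m + 1) →ₗ[k] D.X m, ∀ m x,
      f (m + 1) (g (m + 1) x) = x + D.d m (v m x) + v (m + 1) (D.d (m + 1) x)

/-- A homotopy equivalence followed by an isomorphism of complexes is a homotopy
equivalence. -/
lemma IsHomotopyEquiv.comp_iso {f : ∀ m, C.X m →ₗ[k] D.X m} (hf : IsHomotopyEquiv f)
    {e : ∀ m, D.X m →ₗ[k] E.X m} (he : IsChainMap e) (i : ∀ m, E.X m →ₗ[k] D.X m)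
    (hie : ∀ m x, i m (e m x) = x) (hei : ∀ m x, e m (i m x) = x) :
    IsHomotopyEquiv (C := C) (D := E) fun m => (e m).comp (f m) := by
  obtain ⟨hf, g, hg, ⟨u, hu⟩, v, hv⟩ := hf
  have hi : ∀ m x, i (m + 1) (E.d m x) = D.d m (i m x) := fun m x => by
    rw [← hie (m + 1) (D.d m (i m x)), he, hei]
  refine ⟨fun m x => ?_, fun m => (g m).comp (i m), fun m x => ?_, ⟨u, fun m x => ?_⟩,
    fun m => (e m).comp ((v m).comp (i (m + 1))), fun m x => ?_⟩
  · simp only [LinearMap.comp_apply]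
    rw [hf, he]
  · simp only [LinearMap.comp_apply]
    rw [hi, hg]
  · simp only [LinearMap.comp_apply]
    rw [hie, hu]
  · simp only [LinearMap.comp_apply]
    rw [hv, map_add, map_add, hei, he, hi]

/-- A homotopy equivalence is a quasi-isomorphism. -/
lemma IsHomotopyEquiv.isQuasiIsoRaw {f : ∀ m, C.X m →ₗ[k] D.X m}
    (h : IsHomotopyEquiv f) : IsQuasiIsoRaw f := by
  obtain ⟨hf, g, hg, ⟨u, hu⟩, v, hv⟩ := h
  rintro m ⟨c, e⟩ hx
  have h1 : -C.d (m + 1 + 1) c = 0 := congrArg Prod.fst hx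
  have h2 : f (m + 1 + 1) c + D.d (m + 1) e = 0 := congrArg Prod.snd hx
  rw [neg_eq_zero] at h1
  obtain ⟨c', hc'⟩ : ∃ c', C.d (m + 1) c' = -c := by
    refine ⟨g (m + 1) e + u (m + 1) c, ?_⟩
    have h3 := hu (m + 1) c
    rw [h1, map_zero, add_zero, eq_neg_of_add_eq_zero_left h2, map_neg, hg] at h3
    rw [map_add, ← neg_inj, neg_neg, neg_add, h3]
    abel
  have hz : D.d (m + 1) (e - f (m + 1) c') = 0 := by
    rw [map_sub, ← hf, hc', map_neg, sub_neg_eq_add]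
    exact (add_comm _ _).trans h2
  have h4 := hv m (e - f (m + 1) c')
  rw [hz, map_zero, add_zero] at h4
  refine ⟨(c' + g (m + 1) (e - f (m + 1) c'), -v m (e - f (m + 1) c')), ?_⟩
  refine Prod.ext ?_ ?_
  · show -C.d (m + 1) (c' + g (m + 1) (e - f (m + 1) c')) = c
    rw [map_add, ← hg, hz, map_zero, add_zero, hc', neg_neg]
  · show f (m + 1) (c' + g (m + 1) (e - f (m + 1) c')) +
      D.d m (-v m (e - f (m + 1) c')) = e
    rw [map_add, h4, map_neg]
    abel

/-- A homotopy retract of an exact complex is exact. -/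
lemma ZComplex.Exact.of_homotopyRetract (hC : C.Exact) (f : ∀ m, C.X m →ₗ[k] D.X m)
    (g : ∀ m, D.X m →ₗ[k] C.X m) (hf : IsChainMap f) (hg : IsChainMap g)
    (v : ∀ m, D.X (m + 1) →ₗ[k] D.X m)
    (hv : ∀ m x, f (m + 1) (g (m + 1) x) = x + D.d m (v m x) + v (m + 1) (D.d (m + 1) x)) :
    D.Exact := by
  intro m z hz
  obtain ⟨c, hc⟩ := hC m (g (m + 1) z) (by rw [← hg, hz, map_zero])
  refine ⟨f m c - v m z, ?_⟩
  have h := hv m z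
  rw [hz, map_zero, add_zero] at h
  rw [map_sub, ← hf, hc, h, add_sub_cancel_right]

lemma IsHomotopyEquiv.exact_iff {f : ∀ m, C.X m →ₗ[k] D.X m}
    (h : IsHomotopyEquiv f) : C.Exact ↔ D.Exact := by
  obtain ⟨hf, g, hg, ⟨u, hu⟩, v, hv⟩ := h
  exact ⟨fun hC => hC.of_homotopyRetract f g hf hg v hv,
    fun hD => hD.of_homotopyRetract g f hg hf u hu⟩

end Homotopy

section Comparison

variable {k : Type} [CommRing k] {P : Type} [PartialOrder P]

/-- The total complexes of two free resolutions of the same representation are homotopy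
equivalent. -/
lemma FreeRes.exists_isHomotopyEquiv {A : PRepOp k P} (R R' : FreeRes k P A)
    (M : ℤ → PRep k P) (dM : ∀ s, RepHom (M s) (M (s + 1))) :
    ∃ f : ∀ m, (TotalTensor R M dM).X m →ₗ[k] (TotalTensor R' M dM).X m,
      IsHomotopyEquiv f := by
  obtain ⟨α, hα₀, hα⟩ := FreeRes.exists_chainMap R R'
  obtain ⟨β, hβ₀, hβ⟩ := FreeRes.exists_chainMap R' R
  obtain ⟨η, hη₀, hη⟩ := FreeRes.exists_homotopy R (fun t => (β t).comp (α t))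
    (fun p x => by simp only [RepOpHom.comp_apply, hα₀, hβ₀])
    (fun t p x => by simp only [RepOpHom.comp_apply, hα, hβ])
  obtain ⟨ξ, hξ₀, hξ⟩ := FreeRes.exists_homotopy R' (fun t => (α t).comp (β t))
    (fun p x => by simp only [RepOpHom.comp_apply, hα₀, hβ₀])
    (fun t p x => by simp only [RepOpHom.comp_apply, hα, hβ])
  obtain ⟨u, hu⟩ := totalMap_homotopy R M dM (fun t => (β t).comp (α t)) η hη₀ hη
  obtain ⟨w, hw⟩ := totalMap_homotopy R' M dM (fun t => (α t).comp (β t)) ξ hξ₀ hξ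
  exact ⟨fun m => totalMap R R' M (σ := fun t => t) (fun _ => rfl) α,
    totalMap_d R M dM R' α hα,
    fun m => totalMap R' R M (σ := fun t => t) (fun _ => rfl) β,
    totalMap_d R' M dM R β hβ,
    ⟨u, fun m x => (totalMap_comp R M R' R α β _ x).trans (hu m x)⟩,
    w, fun m x => (totalMap_comp R' M R R' β α _ x).trans (hw m x)⟩

end Comparison

end PosetRep

theorem statement_4 (k : Type) [CommRing k] (P : Type) [PartialOrder P]
    [OrderTop P] [Finite P]
    (M : ℤ → PRep k P) (dM : ∀ s, RepHom (M s) (M (s + 1)))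
    (hM : ∀ (s : ℤ) (p : P) (x : (M s).M p), (dM (s + 1)).f p ((dM s).f p x) = 0)
    (hbdd : ∃ s₀ : ℤ, ∀ s : ℤ, s < s₀ → ∀ (p : P) (x : (M s).M p), x = 0)
    (G : FreeRes k P (kStar k P)) (F : FreeRes k P (SimpleOp k P ⊤ k)) :
    -- the canonical map `G ⊗ M → M_{1̂}` is a chain map, and
    IsChainMap (C := TotalTensor G M dM) (D := TopComplex M dM)
      (augToTop G M dM) ∧
    -- `F ⊗ M` is quasi-isomorphic to `cone(G ⊗ M → M_{1̂})`:
    (∃ φ : ∀ m : ℤ, (TotalTensor F M dM).X m →ₗ[k]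
        (mapConeRaw (augToTop G M dM)).X m,
      IsChainMap (C := TotalTensor F M dM)
        (D := mapConeRaw (augToTop G M dM)) φ ∧
      IsQuasiIsoRaw φ) ∧
    -- in particular:
    (ZComplex.Exact (TotalTensor F M dM) ↔ IsQuasiIsoRaw (augToTop G M dM)) := by
  obtain ⟨a, ha⟩ := FreeRes.exists_isHomotopyEquiv F (cofiberRes G) M dM
  have hf := ha.comp_iso (E := mapConeRaw (augToTop G M dM)) (e := totalToCone G M)
    (totalToCone_totalD G M dM) (coneToTotal G M) (coneToTotal_totalToCone G M)
    (totalToCone_coneToTotal G M)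
  exact ⟨totalAug_totalD G M dM, ⟨_, hf.1, hf.isQuasiIsoRaw⟩, hf.exact_iff⟩
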